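/- arXiv:2412.10386 — 2 statements merged into one kernel-verified Lean document; each statement's English description precedes it below -/
import Mathlib

section
/- For every network of timed automata A^n = A1 || … || An, every lasso-shaped run ρ of A^n, and every finite set of events C ⊆ E(A^n), every run of the counterfactual network is a run of the original network: Π((A1 ∩ A^{C|1}_{ρ(A1)}) || … || (An ∩ A^{C|n}_{ρ(An)})) ⊆ Π(A1 || … || An), where ∩ intersects component and counterfactual trace automaton on actions. -/
open scoped Classical

noncomputable section

/-! ### Basic real-time machinery -/

abbrev Time := NNReal
abbrev ClockVal (X : Type) := X → Time
abbrev Guard (X : Type) := Set (ClockVal X)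
abbrev ClockUpdate (X : Type) := X → Option Time

/-- Apply a (partial, constant-valued) clock update to a clock valuation. -/
def applyUpdate {X : Type} (U : ClockUpdate X) (u : ClockVal X) : ClockVal X :=
  fun x => (U x).getD (u x)

/-- Let `δ` time units pass in the clock valuation `u`. -/
def shiftVal {X : Type} (u : ClockVal X) (δ : Time) : ClockVal X :=
  fun x => u x + δ

/-- An edge of a timed automaton: source, guard, action, clock update, target. -/
structure TAEdge (Loc Act X : Type) where
  src : Loc
  guard : Guard X
  act : Act
  upd : ClockUpdate X
  dst : Loc

/-- A timed automaton with locations `Loc`, actions `Act`, clocks `X` and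
atomic propositions `AP` (guards and invariants are taken semantically,
i.e. as sets of clock valuations). -/
structure TA (Loc Act X AP : Type) where
  init : Loc
  edges : Set (TAEdge Loc Act X)
  inv : Loc → Guard X
  lbl : Loc → Set AP

/-- An (infinite) run of a timed automaton: an alternating sequence of delay and
action transitions starting in the initial location with all clocks zero.
Transition `t` leads from state `t` to state `t + 1`, first delaying `delay t`
and then performing action `act t` (so the paper's `1`-based index `i`
corresponds to our index `i - 1`). -/
structure TARun {Loc Act X AP : Type} (A : TA Loc Act X AP) where
  loc : ℕ → Loc
  clk : ℕ → ClockVal X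
  delay : ℕ → Time
  act : ℕ → Act
  init_loc : loc 0 = A.init
  init_clk : clk 0 = fun _ => 0
  step : ∀ t, ∃ e ∈ A.edges, e.src = loc t ∧ e.act = act t ∧ e.dst = loc (t + 1) ∧
    (∀ δ' ≤ delay t, shiftVal (clk t) δ' ∈ A.inv (loc t)) ∧
    shiftVal (clk t) (delay t) ∈ e.guard ∧
    clk (t + 1) = applyUpdate e.upd (shiftVal (clk t) (delay t)) ∧
    clk (t + 1) ∈ A.inv (loc (t + 1))

/-- A lasso-shaped run: after the loop start `start`, everything repeats with
period `len - start` (where `len` is the length `|ρ|` of the lasso, i.e. the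
position right after the last transition of the loop). -/
structure LassoRun {Loc Act X AP : Type} (A : TA Loc Act X AP) extends TARun A where
  start : ℕ
  len : ℕ
  start_lt : start < len
  loop_loc : ∀ t, start ≤ t → loc (t + (len - start)) = loc t
  loop_clk : ∀ t, start ≤ t → clk (t + (len - start)) = clk t
  loop_delay : ∀ t, start ≤ t → delay (t + (len - start)) = delay t
  loop_act : ∀ t, start ≤ t → act (t + (len - start)) = act t

/-- Accumulated delay before state `i`, i.e. `δ(0, i)`. -/
def cumDelay {Loc Act X AP : Type} {A : TA Loc Act X AP} (ρ : TARun A) : ℕ → Time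
  | 0 => 0
  | t + 1 => cumDelay ρ t + ρ.delay t

abbrev TASignal (AP : Type) := Time → Set AP

/-- The signal of a run: `σ^ρ(t)` is the label of the location occupied at
global time `t` (left-closed right-open semantics). -/
def TARun.signal {Loc Act X AP : Type} {A : TA Loc Act X AP} (ρ : TARun A) : TASignal AP :=
  fun t => {p | ∃ i, cumDelay ρ i ≤ t ∧ t < cumDelay ρ (i + 1) ∧ p ∈ A.lbl (ρ.loc i)}

/-- The language of a timed automaton: the set of signals of its runs. -/
def TA.lang {Loc Act X AP : Type} (A : TA Loc Act X AP) : Set (TASignal AP) :=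
  {σ | ∃ ρ : TARun A, ρ.signal = σ}

/-! ### MITL -/

/-- A non-singleton interval with natural endpoints (possibly unbounded). -/
structure TimeInterval where
  lo : ℕ
  hi : WithTop ℕ
  lo_open : Bool
  hi_open : Bool
  nonsingleton : (lo : WithTop ℕ) < hi

def TimeInterval.mem (I : TimeInterval) (t : Time) : Prop :=
  (if I.lo_open then (I.lo : Time) < t else (I.lo : Time) ≤ t) ∧
  (match I.hi with
    | ⊤ => True
    | (b : ℕ) => if I.hi_open then t < (b : Time) else t ≤ (b : Time))

/-- Metric Interval Temporal Logic. -/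
inductive MITL (AP : Type) where
  | atom : AP → MITL AP
  | not : MITL AP → MITL AP
  | and : MITL AP → MITL AP → MITL AP
  | until : TimeInterval → MITL AP → MITL AP → MITL AP

/-- Satisfaction of an MITL formula by a signal at a time point. -/
def MITL.sat {AP : Type} (σ : TASignal AP) : MITL AP → Time → Prop
  | .atom p, t => p ∈ σ t
  | .not φ, t => ¬ MITL.sat σ φ t
  | .and φ ψ, t => MITL.sat σ φ t ∧ MITL.sat σ ψ t
  | .until I φ ψ, t => ∃ t', t < t' ∧ I.mem (t' - t) ∧ MITL.sat σ ψ t' ∧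
      ∀ t'', t < t'' → t'' < t' → MITL.sat σ φ t''

/-- A run satisfies an MITL formula iff its signal does at time `0`. -/
def TARun.sat {Loc Act X AP : Type} {A : TA Loc Act X AP} (ρ : TARun A) (φ : MITL AP) : Prop :=
  MITL.sat ρ.signal φ 0

/-- A timed automaton satisfies an MITL formula iff all of its runs do. -/
def TA.sat {Loc Act X AP : Type} (A : TA Loc Act X AP) (φ : MITL AP) : Prop :=
  ∀ ρ : TARun A, ρ.sat φ

/-! ### Networks of timed automata -/

/-- Actions of a network: the action together with the (handles of the) two
participating component automata `⟨Ai, Aj, α⟩`. -/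
abbrev NetAct (n : ℕ) (Act : Type) := Fin n × Fin n × Act

def participates {n : ℕ} {Act : Type} (i : Fin n) (a : NetAct n Act) : Prop :=
  i = a.1 ∨ i = a.2.1

/-- The original component action of a network action (`bar` is the
complementation of synchronizing actions). -/
def actionOf {n : ℕ} {Act : Type} (bar : Act → Act) (i : Fin n) (a : NetAct n Act) : Act :=
  if i = a.1 then a.2.2 else bar a.2.2

/-- The network `A1 || … || An` obtained by parallel composition, with
internal and synchronized edges. -/
def Network {n : ℕ} {Loc Act X AP : Type} (A : Fin n → TA Loc Act X AP) (bar : Act → Act) :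
    TA (Fin n → Loc) (NetAct n Act) X AP where
  init := fun i => (A i).init
  inv := fun q => {u | ∀ i, u ∈ (A i).inv (q i)}
  lbl := fun q => {p | ∃ i, p ∈ (A i).lbl (q i)}
  edges := {e |
    (∃ i, ∃ e' ∈ (A i).edges, e.act = (i, i, e'.act) ∧
      e.guard = e'.guard ∧ e.upd = e'.upd ∧
      e.src i = e'.src ∧ e.dst i = e'.dst ∧ ∀ j, j ≠ i → e.dst j = e.src j) ∨
    (∃ i j, i ≠ j ∧ ∃ ei ∈ (A i).edges, ∃ ej ∈ (A j).edges,
      ej.act = bar ei.act ∧ e.act = (i, j, ei.act) ∧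
      e.guard = ei.guard ∩ ej.guard ∧
      e.upd = (fun x => (ei.upd x).orElse fun _ => ej.upd x) ∧
      e.src i = ei.src ∧ e.src j = ej.src ∧ e.dst i = ei.dst ∧ e.dst j = ej.dst ∧
      ∀ k, k ≠ i → k ≠ j → e.dst k = e.src k)}

/-! ### Local projections -/

/-- A (possibly finite) trace: a sequence of pairs of delays and actions. -/
abbrev TATrace (Act : Type) := ℕ → Option (Time × Act)

/-- `HasNth p k` says that the set `{t | p t}` has at least `k + 1` elements. -/
def HasNth (p : ℕ → Prop) (k : ℕ) : Prop :=
  {t | p t}.Infinite ∨ k < {t | p t}.ncard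

/-- The local projection `ρ(Ai)` of a network run: the `k`-th action is the
component's own action at its `k`-th event point and the `k`-th delay is the
cumulative global delay since the previous event point of the component. -/
def localProj {n : ℕ} {L X AP Act : Type} {N : TA L (NetAct n Act) X AP} (bar : Act → Act)
    (ρ : TARun N) (i : Fin n) : TATrace Act :=
  fun k =>
    let p : ℕ → Prop := fun t => participates i (ρ.act t)
    if HasNth p k then
      some (Prod.mk
        (∑ t ∈ Finset.Icc (if k = 0 then 0 else Nat.nth p (k - 1) + 1) (Nat.nth p k), ρ.delay t)
        (actionOf bar i (ρ.act (Nat.nth p k))))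
    else none

/-- `localize(ρ, A^n)`: the tuple of all local projections. -/
def localize {n : ℕ} {L X AP Act : Type} {N : TA L (NetAct n Act) X AP} (bar : Act → Act)
    (ρ : TARun N) : Fin n → TATrace Act :=
  fun i => localProj bar ρ i

/-- The sequence `locations(ρ, Ai)` of local locations of component `i`. -/
def locSeq {n : ℕ} {Loc X AP Act : Type} {N : TA (Fin n → Loc) (NetAct n Act) X AP}
    (ρ : TARun N) (i : Fin n) : ℕ → Loc :=
  fun k =>
    if k = 0 then ρ.loc 0 i
    else ρ.loc (Nat.nth (fun t => participates i (ρ.act t)) (k - 1) + 1) i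

/-- The length `|ρ(Ai)|` of the local projection of a lasso-shaped run: the
number of event points of component `i` among the first `|ρ|` transitions. -/
def localLen {n : ℕ} {L X AP Act : Type} {N : TA L (NetAct n Act) X AP}
    (ρ : LassoRun N) (i : Fin n) : ℕ :=
  ((Finset.range ρ.len).filter fun t => participates i (ρ.act t)).card

/-- The local loop start of the projection of a lasso-shaped run. -/
def localStart {n : ℕ} {L X AP Act : Type} {N : TA L (NetAct n Act) X AP}
    (ρ : LassoRun N) (i : Fin n) : ℕ :=
  ((Finset.range ρ.start).filter fun t => participates i (ρ.act t)).card

/-! ### Events -/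

/-- An event is a delay event `(δ, i)` or an action event `(α, i)`
(indices are `1`-based, as in the paper). -/
abbrev TAEvent (Act : Type) := (Time ⊕ Act) × ℕ

/-- Events of a network: an event together with the component it refers to. -/
abbrev NetEvent (n : ℕ) (Act : Type) := TAEvent Act × Fin n

/-- The events of a (lasso-shaped) trace, restricted to positions `1, …, len`. -/
def traceEvents {Act : Type} (π : TATrace Act) (len : ℕ) : Set (TAEvent Act) :=
  {ev | ∃ k < len, ∃ δ a, π k = some (δ, a) ∧ (ev = (Sum.inl δ, k + 1) ∨ ev = (Sum.inr a, k + 1))}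

/-- `E_ρ`: the events on a lasso-shaped run of a network. -/
def runEvents {n : ℕ} {L X AP Act : Type} {N : TA L (NetAct n Act) X AP} (bar : Act → Act)
    (ρ : LassoRun N) : Set (NetEvent n Act) :=
  {ev | ev.1 ∈ traceEvents (localProj bar ρ.toTARun ev.2) (localLen ρ ev.2)}

/-- `C|k`: the events of component `k` in a set of network events. -/
def restrictC {n : ℕ} {Act : Type} (C : Set (NetEvent n Act)) (i : Fin n) :
    Set (TAEvent Act) :=
  {e | (e, i) ∈ C}

/-! ### Counterfactual trace automata and contingency automata -/

/-- `dst` for (0-based) lasso positions: the successor position in the lasso. -/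
def dstIdx (start len j : ℕ) : ℕ := if j + 1 < len then j + 1 else start

/-- The counterfactual trace automaton `A^C_π` of a lasso-shaped trace `π`
(with loop start `start` and length `len`) for the set of events `C`; `d` is
its (fresh) clock within the clock type `X`. -/
def CTA {Act X : Type} (AP : Type) (π : TATrace Act) (C : Set (TAEvent Act))
    (start len : ℕ) (d : X) : TA ℕ Act X AP where
  init := 0
  lbl := fun _ => ∅
  inv := fun q => {u | ∀ δ a, q < len → π q = some (δ, a) → (Sum.inl δ, q + 1) ∉ C → u d ≤ δ}
  edges := {e | ∃ j < len, ∃ δ a, π j = some (δ, a) ∧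
    e.src = j ∧ e.dst = dstIdx start len j ∧
    e.upd = (fun x => if x = d then some 0 else none) ∧
    (((Sum.inl δ, j + 1) ∈ C ∧ e.guard = Set.univ) ∨
      ((Sum.inl δ, j + 1) ∉ C ∧ e.guard = {u | u d = δ})) ∧
    ((Sum.inr a, j + 1) ∈ C ∨ e.act = a)}

/-- Lift a timed automaton over clocks `X` to the larger clock set `X ⊕ K`. -/
def liftTA {Loc Act X AP : Type} (A : TA Loc Act X AP) (K : Type) :
    TA Loc Act (X ⊕ K) AP where
  init := A.init
  inv := fun q => {u | (fun x => u (Sum.inl x)) ∈ A.inv q}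
  lbl := A.lbl
  edges := {e | ∃ e' ∈ A.edges, e.src = e'.src ∧ e.dst = e'.dst ∧ e.act = e'.act ∧
    e.guard = {u | (fun x => u (Sum.inl x)) ∈ e'.guard} ∧
    e.upd = fun x => match x with | Sum.inl y => e'.upd y | Sum.inr _ => none}

/-- Intersection of two timed automata over the same clocks and actions,
synchronizing on actions; the labels are taken from the first operand. -/
def interS {L1 L2 Act X AP AP2 : Type} (A : TA L1 Act X AP) (B : TA L2 Act X AP2) :
    TA (L1 × L2) Act X AP where
  init := (A.init, B.init)
  inv := fun q => A.inv q.1 ∩ B.inv q.2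
  lbl := fun q => A.lbl q.1
  edges := {e | ∃ ea ∈ A.edges, ∃ eb ∈ B.edges, ea.act = e.act ∧ eb.act = e.act ∧
    e.src = (ea.src, eb.src) ∧ e.dst = (ea.dst, eb.dst) ∧
    e.guard = ea.guard ∩ eb.guard ∧
    e.upd = fun x => (ea.upd x).orElse fun _ => eb.upd x}

/-- The location contingency automaton of an automaton, given the sequence of
locations of the original run and the (local) loop data. -/
def locContingency {Loc Act X AP : Type} (A : TA Loc Act X AP) (seq : ℕ → Loc)
    (start len : ℕ) : TA (Loc × ℕ) Act X AP where
  init := (A.init, 0)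
  inv := fun q => A.inv q.1
  lbl := fun q => A.lbl q.1
  edges := {e | ∃ e' ∈ A.edges, ∃ j < len, e.src = (e'.src, j) ∧
    e.guard = e'.guard ∧ e.act = e'.act ∧ e.upd = e'.upd ∧
    (e.dst = (e'.dst, dstIdx start len j) ∨
      e.dst = (seq (dstIdx start len j), dstIdx start len j))}

/-- The clock contingency automaton of an automaton, given the clock resets
corresponding to the original run and the loop data. -/
def clkContingency {Loc Act X AP : Type} (A : TA Loc Act X AP) (reset : ℕ → ClockUpdate X)
    (start len : ℕ) : TA (Loc × ℕ) Act X AP where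
  init := (A.init, 0)
  inv := fun q => A.inv q.1
  lbl := fun q => A.lbl q.1
  edges := {e | ∃ e' ∈ A.edges, ∃ j < len, e.src = (e'.src, j) ∧
    e.guard = e'.guard ∧ e.act = e'.act ∧ e.dst = (e'.dst, dstIdx start len j) ∧
    (e.upd = e'.upd ∨ e.upd = reset (dstIdx start len j))}

/-! ### Counterfactual networks and causes -/

/-- The counterfactual network
`(A1 ∩ A^{C|1}_{ρ(A1)}) || … || (An ∩ A^{C|n}_{ρ(An)})`, where each
counterfactual trace automaton gets its own fresh clock `Sum.inr i`. -/
def cfNetwork {n : ℕ} {Loc Act X AP : Type} (A : Fin n → TA Loc Act X AP) (bar : Act → Act)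
    (ρ : LassoRun (Network A bar)) (C : Set (NetEvent n Act)) :
    TA (Fin n → Loc × ℕ) (NetAct n Act) (X ⊕ Fin n) AP :=
  Network (fun i =>
    interS (liftTA (A i) (Fin n))
      (CTA AP (localProj bar ρ.toTARun i) (restrictC C i)
        (localStart ρ i) (localLen ρ i) (Sum.inr i))) bar

/-- The counterfactual network with contingencies
`((A1^{loc(ρ)} ∩ A^{C|1}_{ρ(A1)}) || … || (An^{loc(ρ)} ∩ A^{C|n}_{ρ(An)}))^{clk(ρ)}`. -/
def cfActNetwork {n : ℕ} {Loc Act X AP : Type} (A : Fin n → TA Loc Act X AP) (bar : Act → Act)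
    (ρ : LassoRun (Network A bar)) (C : Set (NetEvent n Act)) :
    TA ((Fin n → (Loc × ℕ) × ℕ) × ℕ) (NetAct n Act) (X ⊕ Fin n) AP :=
  clkContingency
    (Network (fun i =>
      interS
        (liftTA (locContingency (A i) (locSeq ρ.toTARun i) (localStart ρ i) (localLen ρ i))
          (Fin n))
        (CTA AP (localProj bar ρ.toTARun i) (restrictC C i)
          (localStart ρ i) (localLen ρ i) (Sum.inr i))) bar)
    (fun j x => match x with | Sum.inl y => some (ρ.clk j y) | Sum.inr _ => none)
    ρ.start ρ.len

/-- `SAT`: cause and effect are satisfied by the actual run. -/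
def SATcond {n : ℕ} {Loc Act X AP : Type} {A : Fin n → TA Loc Act X AP} (bar : Act → Act)
    (ρ : LassoRun (Network A bar)) (φ : MITL AP) (C : Set (NetEvent n Act)) : Prop :=
  C ⊆ runEvents bar ρ ∧ ρ.toTARun.sat φ

/-- `CF_BF`: some intervention on the events in `C` avoids the effect. -/
def CFBF {n : ℕ} {Loc Act X AP : Type} (A : Fin n → TA Loc Act X AP) (bar : Act → Act)
    (ρ : LassoRun (Network A bar)) (φ : MITL AP) (C : Set (NetEvent n Act)) : Prop :=
  ¬ (cfNetwork A bar ρ C).sat φ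

/-- `CF_Act`: some intervention together with location and clock contingencies
avoids the effect. -/
def CFAct {n : ℕ} {Loc Act X AP : Type} (A : Fin n → TA Loc Act X AP) (bar : Act → Act)
    (ρ : LassoRun (Network A bar)) (φ : MITL AP) (C : Set (NetEvent n Act)) : Prop :=
  ¬ (cfActNetwork A bar ρ C).sat φ

/-- But-for cause: a finite set of events satisfying SAT, CF_BF and MIN. -/
def IsButForCause {n : ℕ} {Loc Act X AP : Type} (A : Fin n → TA Loc Act X AP) (bar : Act → Act)
    (ρ : LassoRun (Network A bar)) (φ : MITL AP) (C : Set (NetEvent n Act)) : Prop :=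
  C.Finite ∧ SATcond bar ρ φ C ∧ CFBF A bar ρ φ C ∧
    ∀ C' ⊂ C, ¬ (SATcond bar ρ φ C' ∧ CFBF A bar ρ φ C')

/-- Actual cause: a finite set of events satisfying SAT, CF_Act and MIN. -/
def IsActualCause {n : ℕ} {Loc Act X AP : Type} (A : Fin n → TA Loc Act X AP) (bar : Act → Act)
    (ρ : LassoRun (Network A bar)) (φ : MITL AP) (C : Set (NetEvent n Act)) : Prop :=
  C.Finite ∧ SATcond bar ρ φ C ∧ CFAct A bar ρ φ C ∧
    ∀ C' ⊂ C, ¬ (SATcond bar ρ φ C' ∧ CFAct A bar ρ φ C')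

end

/-- Every edge of the intersection of a lifted timed automaton with a counterfactual trace
automaton over a fresh clock restricts to an edge of the original automaton. -/
theorem exists_edge_of_mem_interS_liftTA_CTA {Loc Act X AP K : Type} {A : TA Loc Act X AP}
    {π : TATrace Act} {C : Set (TAEvent Act)} {start len : ℕ} {k : K}
    {e : TAEdge (Loc × ℕ) Act (X ⊕ K)}
    (he : e ∈ (interS (liftTA A K) (CTA AP π C start len (Sum.inr k))).edges) :
    ∃ e' ∈ A.edges, e'.src = e.src.1 ∧ e'.dst = e.dst.1 ∧ e'.act = e.act ∧
      (∀ u ∈ e.guard, (fun x => u (Sum.inl x)) ∈ e'.guard) ∧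
      ∀ x, e.upd (Sum.inl x) = e'.upd x := by
  obtain ⟨ea, ⟨e', he', hsrc, hdst, hact, hguard, hupd⟩, eb, ⟨j, -, δ, a, -, -, -, hupdb, -⟩,
    hacta, -, hsrce, hdste, hguarde, hupde⟩ := he
  refine ⟨e', he', ?_, ?_, ?_, ?_, ?_⟩
  · rw [hsrce, hsrc]
  · rw [hdste, hdst]
  · rw [← hact, hacta]
  · intro u hu
    rw [hguarde, hguard] at hu
    exact hu.1
  · intro x
    rw [hupde, hupd, hupdb]
    cases h : e'.upd x <;> simp only [h, reduceCtorEq, if_false] <;> rfl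

/-- Every edge of the counterfactual network restricts to an edge of the original network. -/
theorem exists_edge_of_mem_cfNetwork {n : ℕ} {Loc Act X AP : Type}
    {A : Fin n → TA Loc Act X AP} {bar : Act → Act}
    {ρ : LassoRun (Network A bar)} {C : Set (NetEvent n Act)}
    {e : TAEdge (Fin n → Loc × ℕ) (NetAct n Act) (X ⊕ Fin n)}
    (he : e ∈ (cfNetwork A bar ρ C).edges) :
    ∃ e' ∈ (Network A bar).edges, e'.src = (fun i => (e.src i).1) ∧
      e'.dst = (fun i => (e.dst i).1) ∧ e'.act = e.act ∧
      (∀ u ∈ e.guard, (fun x => u (Sum.inl x)) ∈ e'.guard) ∧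
      ∀ x, e.upd (Sum.inl x) = e'.upd x := by
  rcases he with ⟨i, ei, hei, hact, hguard, hupd, hsrc, hdst, hrest⟩ |
    ⟨i, j, hij, ei, hei, ej, hej, hbar, hact, hguard, hupd, hsrci, hsrcj, hdsti, hdstj, hrest⟩
  · obtain ⟨ci, hci, hcsrc, hcdst, hcact, hcguard, hcupd⟩ :=
      exists_edge_of_mem_interS_liftTA_CTA hei
    refine ⟨⟨fun k => (e.src k).1, ci.guard, e.act, ci.upd, fun k => (e.dst k).1⟩,
      Or.inl ⟨i, ci, hci, ?_, rfl, rfl, ?_, ?_, ?_⟩, rfl, rfl, rfl, ?_, ?_⟩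
    · rw [hcact]; exact hact
    · simp [hsrc, hcsrc]
    · simp [hdst, hcdst]
    · intro k hk
      simp [hrest k hk]
    · rw [hguard]; exact hcguard
    · rw [hupd]; exact hcupd
  · obtain ⟨ci, hci, hcisrc, hcidst, hciact, hciguard, hciupd⟩ :=
      exists_edge_of_mem_interS_liftTA_CTA hei
    obtain ⟨cj, hcj, hcjsrc, hcjdst, hcjact, hcjguard, hcjupd⟩ :=
      exists_edge_of_mem_interS_liftTA_CTA hej
    refine ⟨⟨fun k => (e.src k).1, ci.guard ∩ cj.guard, e.act,
        fun x => (ci.upd x).orElse fun _ => cj.upd x, fun k => (e.dst k).1⟩,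
      Or.inr ⟨i, j, hij, ci, hci, cj, hcj, ?_, ?_, rfl, rfl, ?_, ?_, ?_, ?_, ?_⟩,
      rfl, rfl, rfl, ?_, ?_⟩
    · rw [hcjact, hciact, hbar]
    · rw [hciact]; exact hact
    · simp [hsrci, hcisrc]
    · simp [hsrcj, hcjsrc]
    · simp [hdsti, hcidst]
    · simp [hdstj, hcjdst]
    · intro k hki hkj
      simp [hrest k hki hkj]
    · intro u hu
      rw [hguard] at hu
      exact ⟨hciguard u hu.1, hcjguard u hu.2⟩
    · intro x
      simp [hupd, hciupd, hcjupd]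

/-- A valuation satisfying an invariant of the counterfactual network restricts to one
satisfying the corresponding invariant of the original network. -/
theorem mem_inv_of_mem_cfNetwork_inv {n : ℕ} {Loc Act X AP : Type}
    {A : Fin n → TA Loc Act X AP} {bar : Act → Act}
    {ρ : LassoRun (Network A bar)} {C : Set (NetEvent n Act)}
    {q : Fin n → Loc × ℕ} {u : ClockVal (X ⊕ Fin n)} (hu : u ∈ (cfNetwork A bar ρ C).inv q) :
    (fun x => u (Sum.inl x)) ∈ (Network A bar).inv fun i => (q i).1 :=
  fun i => (hu i).1

/-- every run of the counterfactual network is (corresponds to) a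
run of the original network: `Π((A1 ∩ A^{C|1}_{ρ(A1)}) || … || (An ∩ A^{C|n}_{ρ(An)})) ⊆ Π(A1 || … || An)`. -/
theorem cf_runs_subset {n : ℕ} {Loc Act X AP : Type}
    [Finite Loc] [Finite Act] [Finite X] [Finite AP]
    (A : Fin n → TA Loc Act X AP) (bar : Act → Act)
    (ρ : LassoRun (Network A bar)) (C : Set (NetEvent n Act)) (hC : C.Finite) :
    ∀ η : TARun (cfNetwork A bar ρ C), ∃ η' : TARun (Network A bar),
      (∀ t i, η'.loc t i = (η.loc t i).1) ∧
      (∀ t x, η'.clk t x = η.clk t (Sum.inl x)) ∧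
      (∀ t, η'.delay t = η.delay t) ∧
      (∀ t, η'.act t = η.act t) := by
  intro η
  refine ⟨{ loc := fun t i => (η.loc t i).1
            clk := fun t x => η.clk t (Sum.inl x)
            delay := η.delay
            act := η.act
            init_loc := ?_
            init_clk := ?_
            step := ?_ }, fun _ _ => rfl, fun _ _ => rfl, fun _ => rfl, fun _ => rfl⟩
  · funext i
    simp only [η.init_loc]
    rfl
  · simp only [η.init_clk]
  · intro t
    obtain ⟨e, he, hsrc, hact, hdst, hdelay, hguard, hclk, hinv⟩ := η.step t
    obtain ⟨e', he', hsrc', hdst', hact', hguard', hupd'⟩ := exists_edge_of_mem_cfNetwork he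
    refine ⟨e', he', ?_, hact'.trans hact, ?_,
      fun δ hδ => mem_inv_of_mem_cfNetwork_inv (hdelay δ hδ), hguard' _ hguard, ?_,
      mem_inv_of_mem_cfNetwork_inv hinv⟩
    · rw [hsrc', hsrc]
    · rw [hdst', hdst]
    · funext x
      simp [hclk, applyUpdate, shiftVal, hupd']
end

section
/- Existence of an actual cause reduces to the full event set: for every network of timed automata A^n, lasso-shaped run ρ with ρ ⊨ φ, and MITL effect φ, there exists an actual cause for φ in ρ of A^n if and only if the full event set E_ρ of the run fulfills CF_Act. -/
open scoped Classical

/-- `B` relaxes `A`: it has the same locations, initial location and labels, and its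
invariants and guards are weaker. -/
structure TA.Relaxes {Loc Act X AP : Type} (A B : TA Loc Act X AP) : Prop where
  init_eq : A.init = B.init
  lbl_eq : ∀ q, A.lbl q = B.lbl q
  inv_subset : ∀ q, A.inv q ⊆ B.inv q
  edges_lift : ∀ e ∈ A.edges, ∃ g, e.guard ⊆ g ∧ { e with guard := g } ∈ B.edges

theorem TA.Relaxes.sat {Loc Act X AP : Type} {A B : TA Loc Act X AP} (h : A.Relaxes B)
    {φ : MITL AP} (hB : B.sat φ) : A.sat φ := by
  intro ρ
  let ρ' : TARun B :=
    { loc := ρ.loc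
      clk := ρ.clk
      delay := ρ.delay
      act := ρ.act
      init_loc := ρ.init_loc.trans h.init_eq
      init_clk := ρ.init_clk
      step := by
        intro t
        obtain ⟨e, he, hs, ha, hd, hi, hg, hc, hi'⟩ := ρ.step t
        obtain ⟨g, hsub, hmem⟩ := h.edges_lift e he
        exact ⟨_, hmem, hs, ha, hd, fun δ' hδ' => h.inv_subset _ (hi δ' hδ'), hsub hg, hc,
          h.inv_subset _ hi'⟩ }
  have hcum : ∀ i, cumDelay ρ' i = cumDelay ρ i := by
    intro i
    induction i with
    | zero => rfl
    | succ i ih => simp only [cumDelay, ih]; rfl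
  have hsig : ρ'.signal = ρ.signal := by
    funext t
    ext p
    simp only [TARun.signal, Set.mem_ofPred_eq, hcum, h.lbl_eq]
    rfl
  have hsat := hB ρ'
  rwa [TARun.sat, hsig] at hsat

theorem CTA_relaxes {Act X : Type} (AP : Type) (π : TATrace Act) {C D : Set (TAEvent Act)}
    (hCD : C ⊆ D) (start len : ℕ) (d : X) :
    (CTA AP π C start len d).Relaxes (CTA AP π D start len d) where
  init_eq := rfl
  lbl_eq _ := rfl
  inv_subset _ _ hu δ a hq hπ hD := hu δ a hq hπ fun hC => hD (hCD hC)
  edges_lift := by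
    rintro e ⟨j, hj, δ, a, hπ, hs, hd, hU, hg, ha⟩
    have ha' := ha.imp_left (@hCD _)
    by_cases hD : (Sum.inl δ, j + 1) ∈ D
    · exact ⟨Set.univ, Set.subset_univ _, j, hj, δ, a, hπ, hs, hd, hU, .inl ⟨hD, rfl⟩, ha'⟩
    · refine ⟨e.guard, subset_rfl, j, hj, δ, a, hπ, hs, hd, hU, .inr ⟨hD, ?_⟩, ha'⟩
      exact (hg.resolve_left fun h => hD (hCD h.1)).2

theorem TA.Relaxes.interS_right {L1 L2 Act X AP AP2 : Type} (A : TA L1 Act X AP)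
    {B B' : TA L2 Act X AP2} (h : B.Relaxes B') : (interS A B).Relaxes (interS A B') where
  init_eq := by simp only [interS, h.init_eq]
  lbl_eq _ := rfl
  inv_subset q := Set.inter_subset_inter_right _ (h.inv_subset q.2)
  edges_lift := by
    rintro e ⟨ea, hea, eb, heb, haa, hab, hs, hd, hg, hU⟩
    obtain ⟨g, hsub, hmem⟩ := h.edges_lift eb heb
    exact ⟨ea.guard ∩ g, hg ▸ Set.inter_subset_inter_right _ hsub,
      ea, hea, _, hmem, haa, hab, hs, hd, rfl, hU⟩

theorem TA.Relaxes.network {n : ℕ} {Loc Act X AP : Type} {A B : Fin n → TA Loc Act X AP}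
    (h : ∀ i, (A i).Relaxes (B i)) (bar : Act → Act) :
    (Network A bar).Relaxes (Network B bar) where
  init_eq := funext fun i => (h i).init_eq
  lbl_eq q := by simp only [Network, (h _).lbl_eq]
  inv_subset q _ hu i := (h i).inv_subset (q i) (hu i)
  edges_lift := by
    rintro e (⟨i, e', he', ha, hg, hrest⟩ | ⟨i, j, hij, ei, hei, ej, hej, hbar, ha, hg, hrest⟩)
    · obtain ⟨g, hsub, hmem⟩ := (h i).edges_lift e' he'
      exact ⟨g, hg ▸ hsub, .inl ⟨i, _, hmem, ha, rfl, hrest⟩⟩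
    · obtain ⟨gi, hsubi, hmemi⟩ := (h i).edges_lift ei hei
      obtain ⟨gj, hsubj, hmemj⟩ := (h j).edges_lift ej hej
      exact ⟨gi ∩ gj, hg ▸ Set.inter_subset_inter hsubi hsubj,
        .inr ⟨i, j, hij, _, hmemi, _, hmemj, hbar, ha, rfl, hrest⟩⟩

theorem TA.Relaxes.clkContingency {Loc Act X AP : Type} {A B : TA Loc Act X AP}
    (h : A.Relaxes B) (reset : ℕ → ClockUpdate X) (start len : ℕ) :
    (clkContingency A reset start len).Relaxes (clkContingency B reset start len) where
  init_eq := by simp only [_root_.clkContingency, h.init_eq]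
  lbl_eq q := h.lbl_eq q.1
  inv_subset q := h.inv_subset q.1
  edges_lift := by
    rintro e ⟨e', he', j, hj, hs, hg, hrest⟩
    obtain ⟨g, hsub, hmem⟩ := h.edges_lift e' he'
    exact ⟨g, hg ▸ hsub, _, hmem, j, hj, hs, rfl, hrest⟩

theorem CFAct.mono {n : ℕ} {Loc Act X AP : Type} {A : Fin n → TA Loc Act X AP}
    {bar : Act → Act} {ρ : LassoRun (Network A bar)} {φ : MITL AP} {C D : Set (NetEvent n Act)}
    (hCD : C ⊆ D) (hC : CFAct A bar ρ φ C) : CFAct A bar ρ φ D := by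
  have hrelax : (cfActNetwork A bar ρ C).Relaxes (cfActNetwork A bar ρ D) :=
    (TA.Relaxes.network (fun i => (CTA_relaxes AP _ (fun _ he => hCD he) _ _ _).interS_right _)
      bar).clkContingency _ _ _
  exact fun hD => hC (hrelax.sat hD)

theorem traceEvents_finite {Act : Type} (π : TATrace Act) (len : ℕ) :
    (traceEvents π len).Finite := by
  have hfin : (⋃ k ∈ Set.Iio len, {ev : TAEvent Act | ∃ δ a, π k = some (δ, a) ∧
      (ev = (Sum.inl δ, k + 1) ∨ ev = (Sum.inr a, k + 1))}).Finite := by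
    refine (Set.finite_Iio len).biUnion fun k _ => ?_
    rcases hπ : π k with _ | ⟨δ, a⟩
    · simp
    · refine (Set.toFinite {(Sum.inl δ, k + 1), (Sum.inr a, k + 1)}).subset ?_
      rintro ev ⟨δ', a', h, hev⟩
      obtain ⟨rfl, rfl⟩ := Prod.mk.inj (Option.some.inj h)
      exact hev
  refine hfin.subset ?_
  rintro ev ⟨k, hk, hev⟩
  exact Set.mem_biUnion (Set.mem_Iio.mpr hk) hev

theorem runEvents_finite {n : ℕ} {L X AP Act : Type} {N : TA L (NetAct n Act) X AP}
    (bar : Act → Act) (ρ : LassoRun N) : (runEvents bar ρ).Finite := by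
  refine (Set.finite_iUnion fun i : Fin n =>
    (traceEvents_finite (localProj bar ρ.toTARun i) (localLen ρ i)).image (·, i)).subset ?_
  rintro ⟨ev, i⟩ hev
  exact Set.mem_iUnion.mpr ⟨i, ev, hev, rfl⟩

/-- an actual cause for `φ` in `ρ` exists iff the full event set
`E_ρ` fulfills CF_Act. -/
theorem actual_exists_iff_full_CFAct {n : ℕ} {Loc Act X AP : Type}
    [Finite Loc] [Finite Act] [Finite X] [Finite AP]
    (A : Fin n → TA Loc Act X AP) (bar : Act → Act)
    (ρ : LassoRun (Network A bar)) (φ : MITL AP) (hρ : ρ.toTARun.sat φ) :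
    (∃ C : Set (NetEvent n Act), IsActualCause A bar ρ φ C) ↔
      CFAct A bar ρ φ (runEvents bar ρ) := by
  constructor
  · rintro ⟨C, -, hSAT, hCF, -⟩
    exact hCF.mono hSAT.1
  · intro hfull
    have hfin := runEvents_finite bar ρ
    have hcand : {C | SATcond bar ρ φ C ∧ CFAct A bar ρ φ C}.Finite :=
      hfin.finite_subsets.subset fun _ h => h.1.1
    obtain ⟨C, ⟨hSAT, hCF⟩, hmin⟩ := hcand.exists_minimal ⟨_, ⟨subset_rfl, hρ⟩, hfull⟩
    exact ⟨C, hfin.subset hSAT.1, hSAT, hCF, fun C' hC' h => hC'.2 (hmin h hC'.1)⟩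
end
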